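/- arXiv:2411.17963 — 6 statements merged into one kernel-verified Lean document; each statement's English description precedes it below -/
import Mathlib

section
/- Let A be an m×n real matrix, let I ⊆ {1,…,m} and J ⊆ {1,…,n} be index sets of equal size k−1 such that the submatrix A(I,J) is invertible, and let A_{k−1} := A(:,J) · A(I,J)^{-1} · A(I,:) be the associated CUR (skeleton) approximation (with the convention A_0 = 0 when k−1 = 0). Suppose i ∉ I and j ∉ J are such that the residual entry e := (A − A_{k−1})_{i,j} is nonzero. Then the augmented submatrix A(I ∪ {i}, J ∪ {j}) is invertible, and the CUR approximation associated with the augmented index sets satisfies A(:, J ∪ {j}) · A(I ∪ {i}, J ∪ {j})^{-1} · A(I ∪ {i}, :) = A_{k−1} + e^{-1} · (A − A_{k−1})_{:,j} · (A − A_{k−1})_{i,:}, i.e. it is the rank-one update of A_{k−1} by the residual column j times the residual row i divided by the residual pivot entry. -/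
open Matrix

/-- rank-one recursive update of the CUR (skeleton) approximation.
If `A(I,J)` is invertible (with `I,J` of size `k`), `i ∉ I`, `j ∉ J`, and the
residual pivot entry of `A - A(:,J) A(I,J)⁻¹ A(I,:)` at `(i,j)` is nonzero, then
the augmented submatrix is invertible and the augmented CUR approximation is the
rank-one update of the previous one by the residual column times residual row
over the residual pivot. -/
theorem cur_rank_one_update {m n k : ℕ} (A : Matrix (Fin m) (Fin n) ℝ)
    (ι : Fin k → Fin m) (κ : Fin k → Fin n)
    (hι : Function.Injective ι) (hκ : Function.Injective κ)
    (hinv : IsUnit (A.submatrix ι κ))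
    (i : Fin m) (j : Fin n) (hi : i ∉ Set.range ι) (hj : j ∉ Set.range κ)
    (he : (A - A.submatrix id κ * (A.submatrix ι κ)⁻¹ * A.submatrix ι id) i j ≠ 0) :
    IsUnit (A.submatrix (Fin.snoc ι i) (Fin.snoc κ j)) ∧
      A.submatrix id (Fin.snoc κ j) * (A.submatrix (Fin.snoc ι i) (Fin.snoc κ j))⁻¹ *
          A.submatrix (Fin.snoc ι i) id =
        A.submatrix id κ * (A.submatrix ι κ)⁻¹ * A.submatrix ι id +
          ((A - A.submatrix id κ * (A.submatrix ι κ)⁻¹ * A.submatrix ι id) i j)⁻¹ •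
            vecMulVec
              (fun p => (A - A.submatrix id κ * (A.submatrix ι κ)⁻¹ * A.submatrix ι id) p j)
              (fun q => (A - A.submatrix id κ * (A.submatrix ι κ)⁻¹ * A.submatrix ι id) i q) := by
  set M := A.submatrix ι κ with hM
  set C := A.submatrix id κ with hC
  set R := A.submatrix ι id with hR
  set E := A - C * M⁻¹ * R with hE
  have hdet : IsUnit M.det := (Matrix.isUnit_iff_isUnit_det _).1 hinv
  set G := A.submatrix (Fin.snoc ι i : Fin (k + 1) → Fin m)
    (Fin.snoc κ j : Fin (k + 1) → Fin n) with hG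
  have hrow : ∀ a q, E (ι a) q = 0 := by
    intro a q
    have h1 : M * M⁻¹ * R = R := by rw [Matrix.mul_nonsing_inv _ hdet, Matrix.one_mul]
    have h2 : (C * M⁻¹ * R) (ι a) q = (M * M⁻¹ * R) a q := by
      simp only [Matrix.mul_assoc]
      rfl
    rw [hE, Matrix.sub_apply, h2, h1]
    simp [hR]
  have hEj : ∀ p q, E p q = A p q - ∑ a, A p (κ a) * (M⁻¹ * R) a q := by
    intro p q
    rw [hE, Matrix.sub_apply, Matrix.mul_assoc, Matrix.mul_apply]
    rfl
  have hunit : IsUnit G := by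
    rw [← Matrix.mulVec_injective_iff_isUnit]
    intro v w hvw
    have h0 : G *ᵥ (v - w) = 0 := by
      rw [Matrix.mulVec_sub]
      exact sub_eq_zero.2 hvw
    rw [← sub_eq_zero]
    generalize v - w = z at h0
    have hz : ∀ p, G p ⬝ᵥ z = 0 := fun p => congrFun h0 p
    set u : Fin k → ℝ := fun a => z a.castSucc with hu
    set t := z (Fin.last k) with ht
    have hz1 : ∀ a, (M *ᵥ u) a + A (ι a) j * t = 0 := by
      intro a
      have := hz a.castSucc
      simpa [dotProduct, Fin.sum_univ_castSucc, hG, Matrix.mulVec, hM] using this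
    have hz2 : ∑ a, A i (κ a) * u a + A i j * t = 0 := by
      have := hz (Fin.last k)
      simpa [dotProduct, Fin.sum_univ_castSucc, hG] using this
    have hus : ∀ a, u a = - ((M⁻¹ * R) a j * t) := by
      have h3 : M *ᵥ u = - (t • fun a => R a j) := by
        ext a
        have := hz1 a
        simp only [Pi.neg_apply, Pi.smul_apply, smul_eq_mul, hR, Matrix.submatrix_apply, id]
        linarith
      have h4 : u = M⁻¹ *ᵥ (M *ᵥ u) := by
        rw [Matrix.mulVec_mulVec, Matrix.nonsing_inv_mul _ hdet, Matrix.one_mulVec]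
      intro a
      rw [h4, h3, Matrix.mulVec_neg, Matrix.mulVec_smul]
      simp only [Pi.neg_apply, Pi.smul_apply, smul_eq_mul, Matrix.mul_apply, Matrix.mulVec,
        dotProduct]
      ring
    have ht0 : E i j * t = 0 := by
      rw [hEj, sub_mul, Finset.sum_mul]
      simp only [hus, mul_neg, Finset.sum_neg_distrib] at hz2
      simp only [mul_assoc]
      linarith
    have ht1 : t = 0 := (mul_eq_zero.1 ht0).resolve_left he
    ext p
    refine Fin.lastCases ht1 (fun a => ?_) p
    have := hus a
    rw [ht1] at this
    simpa [hu] using this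
  refine ⟨hunit, ?_⟩
  have hGdet : IsUnit G.det := (Matrix.isUnit_iff_isUnit_det _).1 hunit
  set C' := A.submatrix id (Fin.snoc κ j : Fin (k + 1) → Fin n) with hC'
  set R' := A.submatrix (Fin.snoc ι i : Fin (k + 1) → Fin m) id with hR'
  let X : Matrix (Fin (k + 1)) (Fin n) ℝ := fun p q =>
    (Fin.snoc (fun a => (M⁻¹ * R) a q - (E i j)⁻¹ * (M⁻¹ * R) a j * E i q)
      ((E i j)⁻¹ * E i q) : Fin (k + 1) → ℝ) p
  have hCX : ∀ p q, (C' * X) p q = A p q - E p q + (E i j)⁻¹ * (E p j * E i q) := by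
    intro p q
    rw [hEj p q, hEj p j, Matrix.mul_apply, Fin.sum_univ_castSucc]
    simp only [X, hC', Matrix.submatrix_apply, id, Fin.snoc_castSucc, Fin.snoc_last, mul_sub,
      Finset.sum_sub_distrib, sub_mul, Finset.sum_mul, Finset.mul_sum]
    have : ∀ a, A p (κ a) * ((E i j)⁻¹ * (M⁻¹ * R) a j * E i q)
        = (E i j)⁻¹ * (A p (κ a) * (M⁻¹ * R) a j * E i q) := fun a => by ring
    simp only [this]
    ring
  have hGX : G * X = R' := by
    ext p q
    have h5 : (G * X) p q = (C' * X) ((Fin.snoc ι i : Fin (k + 1) → Fin m) p) q := rfl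
    rw [h5, hCX]
    refine Fin.lastCases ?_ (fun a => ?_) p
    · simp only [hR', Matrix.submatrix_apply, id, Fin.snoc_last]
      field_simp
      ring
    · simp [hR', hrow]
  rw [← hGX, Matrix.mul_assoc, ← Matrix.mul_assoc G⁻¹, Matrix.nonsing_inv_mul _ hGdet,
    Matrix.one_mul]
  ext p q
  rw [hCX, Matrix.add_apply, Matrix.smul_apply, Matrix.vecMulVec_apply, smul_eq_mul]
  have : E p q = A p q - (C * M⁻¹ * R) p q := by rw [hE, Matrix.sub_apply]
  rw [this]
  ring
end

section
/- Let A be an m×n real matrix, let I ⊆ {1,…,m} and J ⊆ {1,…,n} be index sets of equal size k−1 such that A(I,J) is invertible, and let A_{k−1} := A(:,J) · A(I,J)^{-1} · A(I,:) (with A_0 = 0 when k−1 = 0). For i ∉ I and j ∉ J, form the k×k submatrix A(I ∪ {i}, J ∪ {j}) with the new row index i appended last and the new column index j appended last. Then det A(I ∪ {i}, J ∪ {j}) = det A(I,J) · (A − A_{k−1})_{i,j}. In particular, A(I ∪ {i}, J ∪ {j}) is invertible if and only if the residual pivot entry (A − A_{k−1})_{i,j} is nonzero. -/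
open Matrix

/-- determinant of the augmented skeleton submatrix.
With `A(I,J)` invertible, `i ∉ I`, `j ∉ J`, and the new row/column appended last,
`det A(I∪{i}, J∪{j}) = det A(I,J) · (A − A_{k−1})_{i,j}`, where
`A_{k−1} = A(:,J) A(I,J)⁻¹ A(I,:)`; in particular the augmented submatrix is
invertible iff the residual pivot entry is nonzero. -/
theorem cur_augmented_det {m n k : ℕ} (A : Matrix (Fin m) (Fin n) ℝ)
    (ι : Fin k → Fin m) (κ : Fin k → Fin n)
    (hι : Function.Injective ι) (hκ : Function.Injective κ)
    (hinv : IsUnit (A.submatrix ι κ))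
    (i : Fin m) (j : Fin n) (hi : i ∉ Set.range ι) (hj : j ∉ Set.range κ) :
    (A.submatrix (Fin.snoc ι i) (Fin.snoc κ j)).det =
        (A.submatrix ι κ).det *
          (A - A.submatrix id κ * (A.submatrix ι κ)⁻¹ * A.submatrix ι id) i j ∧
      (IsUnit (A.submatrix (Fin.snoc ι i) (Fin.snoc κ j)) ↔
        (A - A.submatrix id κ * (A.submatrix ι κ)⁻¹ * A.submatrix ι id) i j ≠ 0) := by
  have key : (A.submatrix (Fin.snoc ι i) (Fin.snoc κ j)).det =
        (A.submatrix ι κ).det *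
          (A - A.submatrix id κ * (A.submatrix ι κ)⁻¹ * A.submatrix ι id) i j := by
    let _ : Invertible (A.submatrix ι κ) := hinv.invertible
    have hb : (A.submatrix (Fin.snoc ι i : Fin (k + 1) → Fin m)
        (Fin.snoc κ j : Fin (k + 1) → Fin n)).submatrix
        (finSumFinEquiv : Fin k ⊕ Fin 1 ≃ Fin (k + 1)) finSumFinEquiv =
        Matrix.fromBlocks (A.submatrix ι κ) (A.submatrix ι (fun _ : Fin 1 => j))
          (A.submatrix (fun _ : Fin 1 => i) κ)
          (A.submatrix (fun _ : Fin 1 => i) (fun _ : Fin 1 => j)) := by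
      have hl : ∀ a : Fin k, Fin.castAdd 1 a = Fin.castSucc a := fun _ => rfl
      have hr : ∀ a : Fin 1, Fin.natAdd k a = Fin.last k := by
        intro a; ext; simp
      ext a b
      rcases a with a | a <;> rcases b with b | b <;>
        simp only [Matrix.submatrix_apply, finSumFinEquiv_apply_left,
          finSumFinEquiv_apply_right, hl, hr, Fin.snoc_castSucc, Fin.snoc_last,
          Matrix.fromBlocks_apply₁₁, Matrix.fromBlocks_apply₁₂,
          Matrix.fromBlocks_apply₂₁, Matrix.fromBlocks_apply₂₂]
    rw [← Matrix.det_submatrix_equiv_self (finSumFinEquiv : Fin k ⊕ Fin 1 ≃ Fin (k + 1)), hb,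
      Matrix.det_fromBlocks₁₁, Matrix.det_unique (n := Fin 1), Matrix.invOf_eq_nonsing_inv]
    rfl
  refine ⟨key, ?_⟩
  have hd : (A.submatrix ι κ).det ≠ 0 :=
    ((Matrix.isUnit_iff_isUnit_det _).1 hinv).ne_zero
  rw [Matrix.isUnit_iff_isUnit_det, key, isUnit_iff_ne_zero, mul_ne_zero_iff]
  exact ⟨fun h => h.2, fun h => ⟨hd, h⟩⟩
end

section
/- Let A be an m×n real matrix and let (i_1,j_1), …, (i_k,j_k) be pivot index pairs. Define recursively A_0 = 0 and, for l = 1,…,k, the residual e_{l−1} := A − A_{l−1} and A_l := A_{l−1} + (e_{l−1})_{i_l,j_l}^{-1} · (e_{l−1})_{:,j_l} · (e_{l−1})_{i_l,:}, assuming each pivot entry (e_{l−1})_{i_l,j_l} is nonzero. Then A_k = E_J · D · E_I, where E_J is the m×k matrix whose l-th column is (e_{l−1})_{:,j_l}, D is the k×k diagonal matrix with diagonal entries (e_{l−1})_{i_l,j_l}^{-1} for l = 1,…,k, and E_I is the k×n matrix whose l-th row is (e_{l−1})_{i_l,:}. -/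
open Matrix

/-- The adaptive cross approximation sequence: `A_0 = 0` and
`A_{l+1} = A_l + e⁻¹ · (residual column) · (residual row)` where `e` is the
pivot entry of the residual `A - A_l` at the `l`-th pivot pair. -/
noncomputable def acaSeq {m n : ℕ} (A : Matrix (Fin m) (Fin n) ℝ)
    (piv : ℕ → Fin m × Fin n) : ℕ → Matrix (Fin m) (Fin n) ℝ
  | 0 => 0
  | l + 1 =>
      acaSeq A piv l +
        ((A - acaSeq A piv l) (piv l).1 (piv l).2)⁻¹ •
          vecMulVec (fun p => (A - acaSeq A piv l) p (piv l).2)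
            (fun q => (A - acaSeq A piv l) (piv l).1 q)

/-- the `k`-th ACA iterate factors as `E_J · D · E_I`, where the
`l`-th column of `E_J` is the `l`-th residual column, `D` is diagonal with the
inverse pivot entries, and the `l`-th row of `E_I` is the `l`-th residual row. -/
theorem acaSeq_eq_EJ_D_EI {m n : ℕ} (A : Matrix (Fin m) (Fin n) ℝ) (k : ℕ)
    (piv : ℕ → Fin m × Fin n)
    (hpiv : ∀ l < k, (A - acaSeq A piv l) (piv l).1 (piv l).2 ≠ 0) :
    acaSeq A piv k =
      (Matrix.of fun (p : Fin m) (l : Fin k) =>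
          (A - acaSeq A piv l.val) p (piv l.val).2) *
        Matrix.diagonal
          (fun l : Fin k => ((A - acaSeq A piv l.val) (piv l.val).1 (piv l.val).2)⁻¹) *
        (Matrix.of fun (l : Fin k) (q : Fin n) =>
          (A - acaSeq A piv l.val) (piv l.val).1 q) := by
  clear hpiv
  ext p q
  rw [Matrix.mul_apply]
  simp only [Matrix.mul_diagonal, Matrix.of_apply]
  induction k with
  | zero => simp [acaSeq]
  | succ k ih =>
    rw [Fin.sum_univ_castSucc]
    simp only [Fin.val_castSucc, Fin.val_last]
    rw [← ih, acaSeq, Matrix.add_apply, Matrix.smul_apply, Matrix.vecMulVec_apply, smul_eq_mul]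
    ring
end

section
/- Let A be an m×n real matrix and let (i_1,j_1), …, (i_k,j_k) be pivot index pairs. Define recursively A_0 = 0 and, for l = 1,…,k, the residual e_{l−1} := A − A_{l−1} and A_l := A_{l−1} + (e_{l−1})_{i_l,j_l}^{-1} · (e_{l−1})_{:,j_l} · (e_{l−1})_{i_l,:}, assuming each pivot entry (e_{l−1})_{i_l,j_l} is nonzero. Then the final residual A − A_k vanishes identically on every selected row and every selected column: (A − A_k)_{i_l, j} = 0 for all l ∈ {1,…,k} and all columns j, and (A − A_k)_{i, j_l} = 0 for all l ∈ {1,…,k} and all rows i. -/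
open Matrix

/-- One step of the residual recursion, entrywise. -/
theorem acaSeq_residual_succ {m n : ℕ} (A : Matrix (Fin m) (Fin n) ℝ)
    (piv : ℕ → Fin m × Fin n) (l : ℕ) (i : Fin m) (j : Fin n) :
    (A - acaSeq A piv (l + 1)) i j = (A - acaSeq A piv l) i j -
      ((A - acaSeq A piv l) (piv l).1 (piv l).2)⁻¹ *
        ((A - acaSeq A piv l) i (piv l).2 * (A - acaSeq A piv l) (piv l).1 j) := by
  simp only [acaSeq, Matrix.sub_apply, Matrix.add_apply, Matrix.smul_apply,
    Matrix.vecMulVec_apply, smul_eq_mul]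
  ring

/-- after `k` ACA steps with nonzero pivots, the residual `A - A_k`
vanishes identically on every selected row and every selected column. -/
theorem acaSeq_residual_vanishes {m n : ℕ} (A : Matrix (Fin m) (Fin n) ℝ) (k : ℕ)
    (piv : ℕ → Fin m × Fin n)
    (hpiv : ∀ l < k, (A - acaSeq A piv l) (piv l).1 (piv l).2 ≠ 0) :
    (∀ l < k, ∀ j : Fin n, (A - acaSeq A piv k) (piv l).1 j = 0) ∧
      (∀ l < k, ∀ i : Fin m, (A - acaSeq A piv k) i (piv l).2 = 0) := by
  induction k with
  | zero => simp
  | succ k ih =>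
    obtain ⟨h1, h2⟩ := ih (fun l hl => hpiv l (by omega))
    have hp := hpiv k (by omega)
    constructor
    · intro l hl j
      rw [acaSeq_residual_succ]
      rcases Nat.lt_succ_iff_lt_or_eq.mp hl with h | rfl
      · rw [h1 l h j, h1 l h]; ring
      · rw [inv_mul_cancel_left₀ hp, sub_self]
    · intro l hl i
      rw [acaSeq_residual_succ]
      rcases Nat.lt_succ_iff_lt_or_eq.mp hl with h | rfl
      · rw [h2 l h i, h2 l h]; ring
      · rw [mul_comm ((A - acaSeq A piv l) i _), inv_mul_cancel_left₀ hp, sub_self]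
end

section
/- Let f_{p,q} ∈ ℝ for p,q ∈ {−1,0,1} be nine given nodal values. Consider bivariate quadratic polynomials p(ξ,η) = a_1 + a_2 ξ + a_3 η + a_4 ξ² + a_5 ξη + a_6 η² subject to the five interpolation constraints p(0,0) = f_{0,0}, p(±1,0) = f_{±1,0}, p(0,±1) = f_{0,±1}. Then: (i) these constraints hold if and only if a_1 = f_{0,0}, a_2 = ½(f_{1,0} − f_{−1,0}), a_3 = ½(f_{0,1} − f_{0,−1}), a_4 = −f_{0,0} + ½(f_{−1,0} + f_{1,0}), a_6 = −f_{0,0} + ½(f_{0,−1} + f_{0,1}), with a_5 unconstrained; and (ii) among all such constrained polynomials, the least-squares functional Σ_{s,t ∈ {−1,1}} (p(s,t) − f_{s,t})² attains its unique minimum when a_5 = ¼(f_{1,1} + f_{−1,−1} − f_{−1,1} − f_{1,−1}). -/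
/-- The bivariate quadratic `a₁ + a₂ξ + a₃η + a₄ξ² + a₅ξη + a₆η²`. -/
noncomputable def quadPoly (a1 a2 a3 a4 a5 a6 ξ η : ℝ) : ℝ :=
  a1 + a2 * ξ + a3 * η + a4 * ξ ^ 2 + a5 * ξ * η + a6 * η ^ 2

/-- The five interpolation constraints at the center and edge neighbors. -/
def interpConstraints (f : ℤ → ℤ → ℝ) (a1 a2 a3 a4 a5 a6 : ℝ) : Prop :=
  quadPoly a1 a2 a3 a4 a5 a6 0 0 = f 0 0 ∧
  quadPoly a1 a2 a3 a4 a5 a6 1 0 = f 1 0 ∧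
  quadPoly a1 a2 a3 a4 a5 a6 (-1) 0 = f (-1) 0 ∧
  quadPoly a1 a2 a3 a4 a5 a6 0 1 = f 0 1 ∧
  quadPoly a1 a2 a3 a4 a5 a6 0 (-1) = f 0 (-1)

/-- The least-squares functional over the four corner values. -/
noncomputable def lsq (f : ℤ → ℤ → ℝ) (a1 a2 a3 a4 a5 a6 : ℝ) : ℝ :=
  (quadPoly a1 a2 a3 a4 a5 a6 1 1 - f 1 1) ^ 2 +
  (quadPoly a1 a2 a3 a4 a5 a6 (-1) (-1) - f (-1) (-1)) ^ 2 +
  (quadPoly a1 a2 a3 a4 a5 a6 (-1) 1 - f (-1) 1) ^ 2 +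
  (quadPoly a1 a2 a3 a4 a5 a6 1 (-1) - f 1 (-1)) ^ 2

/-- (i) the five interpolation constraints hold iff the
coefficients `a₁, a₂, a₃, a₄, a₆` are given by the stated finite-difference
formulas (with `a₅` unconstrained); (ii) among all constrained quadratics the
corner least-squares functional attains its unique minimum at
`a₅ = ¼(f₁₁ + f₋₁₋₁ − f₋₁₁ − f₁₋₁)`. -/
theorem local_reconstruction_coefficients (f : ℤ → ℤ → ℝ) :
    (∀ a1 a2 a3 a4 a5 a6 : ℝ,
      interpConstraints f a1 a2 a3 a4 a5 a6 ↔
        (a1 = f 0 0 ∧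
         a2 = (f 1 0 - f (-1) 0) / 2 ∧
         a3 = (f 0 1 - f 0 (-1)) / 2 ∧
         a4 = -f 0 0 + (f (-1) 0 + f 1 0) / 2 ∧
         a6 = -f 0 0 + (f 0 (-1) + f 0 1) / 2)) ∧
    (∀ a1 a2 a3 a4 a5 a6 : ℝ, interpConstraints f a1 a2 a3 a4 a5 a6 →
      lsq f (f 0 0) ((f 1 0 - f (-1) 0) / 2) ((f 0 1 - f 0 (-1)) / 2)
          (-f 0 0 + (f (-1) 0 + f 1 0) / 2)
          ((f 1 1 + f (-1) (-1) - f (-1) 1 - f 1 (-1)) / 4)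
          (-f 0 0 + (f 0 (-1) + f 0 1) / 2) ≤ lsq f a1 a2 a3 a4 a5 a6 ∧
        (lsq f a1 a2 a3 a4 a5 a6 =
            lsq f (f 0 0) ((f 1 0 - f (-1) 0) / 2) ((f 0 1 - f 0 (-1)) / 2)
              (-f 0 0 + (f (-1) 0 + f 1 0) / 2)
              ((f 1 1 + f (-1) (-1) - f (-1) 1 - f 1 (-1)) / 4)
              (-f 0 0 + (f 0 (-1) + f 0 1) / 2) →
          a5 = (f 1 1 + f (-1) (-1) - f (-1) 1 - f 1 (-1)) / 4)) := by
  have key : ∀ a1 a2 a3 a4 a5 a6 : ℝ,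
      lsq f a1 a2 a3 a4 a5 a6 =
        lsq f a1 a2 a3 a4 ((f 1 1 + f (-1) (-1) - f (-1) 1 - f 1 (-1)) / 4) a6 +
          4 * (a5 - (f 1 1 + f (-1) (-1) - f (-1) 1 - f 1 (-1)) / 4) ^ 2 := by
    intro a1 a2 a3 a4 a5 a6
    unfold lsq quadPoly
    ring
  have coeffs : ∀ a1 a2 a3 a4 a5 a6 : ℝ,
      interpConstraints f a1 a2 a3 a4 a5 a6 ↔
        (a1 = f 0 0 ∧
         a2 = (f 1 0 - f (-1) 0) / 2 ∧
         a3 = (f 0 1 - f 0 (-1)) / 2 ∧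
         a4 = -f 0 0 + (f (-1) 0 + f 1 0) / 2 ∧
         a6 = -f 0 0 + (f 0 (-1) + f 0 1) / 2) := by
    intro a1 a2 a3 a4 a5 a6
    unfold interpConstraints quadPoly
    constructor
    · rintro ⟨h1, h2, h3, h4, h5⟩
      refine ⟨?_, ?_, ?_, ?_, ?_⟩ <;> linarith
    · rintro ⟨h1, h2, h3, h4, h5⟩
      refine ⟨?_, ?_, ?_, ?_, ?_⟩ <;> linarith
  refine ⟨coeffs, ?_⟩
  intro a1 a2 a3 a4 a5 a6 h
  obtain ⟨rfl, rfl, rfl, rfl, rfl⟩ := (coeffs a1 a2 a3 a4 a5 a6).1 h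
  rw [key _ _ _ _ a5 _]
  refine ⟨le_add_of_nonneg_right (by positivity), fun h => ?_⟩
  have h0 : (a5 - (f 1 1 + f (-1) (-1) - f (-1) 1 - f 1 (-1)) / 4) ^ 2 = 0 := by linarith
  exact sub_eq_zero.1 (pow_eq_zero_iff two_ne_zero |>.1 h0)
end

section
/- Let Q(ξ,η) be a bivariate polynomial of total degree at most 2 and set f_{p,q} := Q(p,q) for p,q ∈ {−1,0,1}. Then the quadratic polynomial produced by the constrained least-squares reconstruction—namely the unique p(ξ,η) = a_1 + a_2 ξ + a_3 η + a_4 ξ² + a_5 ξη + a_6 η² interpolating the five values f_{0,0}, f_{±1,0}, f_{0,±1} at (0,0), (±1,0), (0,±1) and minimizing Σ_{s,t ∈ {−1,1}} (p(s,t) − f_{s,t})² over the remaining free coefficient—coincides with Q. In other words, the reconstruction operator reproduces all quadratic polynomials exactly. -/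
/-- if the nodal values come from a bivariate polynomial `Q` of
total degree at most 2 (written `quadPoly q1 … q6`), then the constrained
least-squares reconstruction exists and every constrained minimizer coincides
with `Q`; i.e., the reconstruction reproduces quadratics exactly. -/
theorem reconstruction_reproduces_quadratics (q1 q2 q3 q4 q5 q6 : ℝ)
    (f : ℤ → ℤ → ℝ)
    (hf : ∀ p q : ℤ, f p q = quadPoly q1 q2 q3 q4 q5 q6 (p : ℝ) (q : ℝ)) :
    (∃ a1 a2 a3 a4 a5 a6 : ℝ,
      interpConstraints f a1 a2 a3 a4 a5 a6 ∧
        ∀ b1 b2 b3 b4 b5 b6 : ℝ, interpConstraints f b1 b2 b3 b4 b5 b6 →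
          lsq f a1 a2 a3 a4 a5 a6 ≤ lsq f b1 b2 b3 b4 b5 b6) ∧
    (∀ a1 a2 a3 a4 a5 a6 : ℝ,
      interpConstraints f a1 a2 a3 a4 a5 a6 →
        (∀ b1 b2 b3 b4 b5 b6 : ℝ, interpConstraints f b1 b2 b3 b4 b5 b6 →
          lsq f a1 a2 a3 a4 a5 a6 ≤ lsq f b1 b2 b3 b4 b5 b6) →
        ∀ ξ η : ℝ, quadPoly a1 a2 a3 a4 a5 a6 ξ η = quadPoly q1 q2 q3 q4 q5 q6 ξ η) := by
  have hq : interpConstraints f q1 q2 q3 q4 q5 q6 := by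
    refine ⟨?_, ?_, ?_, ?_, ?_⟩ <;> rw [hf] <;> norm_num
  have h0 : lsq f q1 q2 q3 q4 q5 q6 = 0 := by
    simp only [lsq, hf]
    norm_num
  refine ⟨⟨q1, q2, q3, q4, q5, q6, hq, ?_⟩, ?_⟩
  · intro b1 b2 b3 b4 b5 b6 _
    rw [h0]
    unfold lsq
    positivity
  · intro a1 a2 a3 a4 a5 a6 ha hmin ξ η
    have hle := hmin q1 q2 q3 q4 q5 q6 hq
    rw [h0] at hle
    obtain ⟨e1, e2, e3, e4, e5⟩ := ha
    have e6 : quadPoly a1 a2 a3 a4 a5 a6 1 1 - f 1 1 = 0 := by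
      unfold lsq at hle
      apply pow_eq_zero_iff (two_ne_zero) |>.mp
      apply le_antisymm _ (sq_nonneg _)
      have := sq_nonneg (quadPoly a1 a2 a3 a4 a5 a6 (-1) (-1) - f (-1) (-1))
      have := sq_nonneg (quadPoly a1 a2 a3 a4 a5 a6 (-1) 1 - f (-1) 1)
      have := sq_nonneg (quadPoly a1 a2 a3 a4 a5 a6 1 (-1) - f 1 (-1))
      linarith
    rw [hf] at e1 e2 e3 e4 e5 e6
    simp only [quadPoly] at e1 e2 e3 e4 e5 e6
    norm_num at e1 e2 e3 e4 e5 e6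
    have g1 : a1 = q1 := by linarith
    have g2 : a2 = q2 := by linarith
    have g3 : a3 = q3 := by linarith
    have g4 : a4 = q4 := by linarith
    have g6 : a6 = q6 := by linarith
    have g5 : a5 = q5 := by linarith
    rw [g1, g2, g3, g4, g5, g6]
end
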